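/- Let A be a standard graded algebra over a field k with Hilbert function HF_A(n) = dim_k A_n. Then for all n ≥ 1, HF_A(n+1) ≤ HF_A(n)^{⟨n⟩}, where for d ≥ 0 with the unique binomial expansion d = C(k_n,n) + C(k_{n-1},n−1) + ... + C(k_1,1) with k_n > k_{n-1} > ... > k_1 ≥ 0, one sets d^{⟨n⟩} = C(k_n+1, n+1) + C(k_{n-1}+1, n) + ... + C(k_1+1, 2). -/

import Mathlib

open MvPolynomial

/-- `macaulayPow n d` is `d^⟨n⟩`: writing `d` in its unique Macaulay (binomial) expansion
`d = C(kₙ,n) + C(kₙ₋₁,n−1) + ⋯ + C(k₁,1)` with `kₙ > kₙ₋₁ > ⋯ > k₁ ≥ 0`, it is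
`C(kₙ+1,n+1) + C(kₙ₋₁+1,n) + ⋯ + C(k₁+1,2)` (computed greedily). -/
def macaulayPow : ℕ → ℕ → ℕ
  | 0, d => d
  | n + 1, d =>
    if d = 0 then 0
    else
      let j := Nat.findGreatest (fun i => Nat.choose i (n + 1) ≤ d) (d + n + 1)
      Nat.choose (j + 1) (n + 2) + macaulayPow n (d - Nat.choose j (n + 1))

/-- The Hilbert function of the standard graded algebra `k[x₁,…,x_m]/I`,
for a homogeneous ideal `I`. -/
noncomputable def hilbertFunction (k : Type*) [Field k] (m : ℕ)
    (I : Ideal (MvPolynomial (Fin m) k)) (n : ℕ) : ℕ :=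
  Module.finrank k
    (Submodule.map (Ideal.Quotient.mkₐ k I).toLinearMap (homogeneousSubmodule (Fin m) k n))


namespace MacProof

lemma choose_lin (n i : ℕ) : i + 1 ≤ Nat.choose (i + n + 1) (n + 1) := by
  induction i with
  | zero => simp
  | succ i ih =>
    have h : i + 1 + n + 1 = (i + n + 1) + 1 := by ring
    rw [h, Nat.choose_succ_succ']
    have := Nat.choose_pos (show n ≤ i + n + 1 by omega)
    omega

/-- Green's companion function `d_⟨n⟩`. -/
def greenPow : ℕ → ℕ → ℕ
  | 0, _ => 0
  | n + 1, d =>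
    if d = 0 then 0
    else
      let j := Nat.findGreatest (fun i => Nat.choose i (n + 1) ≤ d) (d + n + 1)
      Nat.choose (j - 1) (n + 1) + greenPow n (d - Nat.choose j (n + 1))

lemma find_eq (n d j : ℕ) (h1 : Nat.choose j (n + 1) ≤ d) (h2 : d < Nat.choose (j + 1) (n + 1)) :
    Nat.findGreatest (fun i => Nat.choose i (n + 1) ≤ d) (d + n + 1) = j := by
  rw [Nat.findGreatest_eq_iff]
  refine ⟨?_, fun _ => h1, ?_⟩
  · by_contra hc
    obtain ⟨i, rfl⟩ : ∃ i, j = i + n + 1 := ⟨j - n - 1, by omega⟩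
    have := choose_lin n i
    omega
  · intro k hk _ hc
    have := Nat.choose_le_choose (n + 1) (show j + 1 ≤ k by omega)
    omega

lemma exists_top (n d : ℕ) (hd : 0 < d) :
    ∃ i, n ≤ i ∧ Nat.choose (i + 1) (n + 1) ≤ d ∧ d < Nat.choose (i + 2) (n + 1) := by
  classical
  have hex : ∃ k, d < Nat.choose (k + n + 2) (n + 1) := ⟨d, by
    have := choose_lin n (d + 1)
    rw [show d + 1 + n + 1 = d + n + 2 by ring] at this; omega⟩
  have hs := Nat.find_spec hex
  have hm := fun k => @Nat.find_min _ _ hex k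
  generalize Nat.find hex = k at hs hm
  refine ⟨k + n, by omega, ?_, hs⟩
  cases k with
  | zero => simp; omega
  | succ k =>
    have := hm k (by omega)
    rw [show k + 1 + n + 1 = k + n + 2 by ring]; omega

@[simp] lemma mac_zero (n : ℕ) : macaulayPow n 0 = 0 := by
  cases n <;> simp [macaulayPow]

@[simp] lemma green_zero (n : ℕ) : greenPow n 0 = 0 := by
  cases n <;> simp [greenPow]

lemma mac_eq (n d j : ℕ) (h1 : Nat.choose j (n + 1) ≤ d) (h2 : d < Nat.choose (j + 1) (n + 1)) :
    macaulayPow (n + 1) d = Nat.choose (j + 1) (n + 2) + macaulayPow n (d - Nat.choose j (n + 1)) := by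
  by_cases hd : d = 0
  · subst hd
    have : j < n + 1 := by
      by_contra hc
      have := Nat.choose_pos (show n + 1 ≤ j by omega)
      omega
    simp [Nat.choose_eq_zero_of_lt (show j + 1 < n + 2 by omega)]
  · simp only [macaulayPow, if_neg hd, find_eq n d j h1 h2]

lemma green_eq (n d j : ℕ) (h1 : Nat.choose (j + 1) (n + 1) ≤ d)
    (h2 : d < Nat.choose (j + 2) (n + 1)) (hd : 0 < d) :
    greenPow (n + 1) d = Nat.choose j (n + 1) + greenPow n (d - Nat.choose (j + 1) (n + 1)) := by
  simp only [greenPow, if_neg hd.ne', find_eq n d (j + 1) h1 h2, Nat.add_sub_cancel]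

lemma mac_one (d : ℕ) : macaulayPow 1 d = Nat.choose (d + 1) 2 := by
  rw [mac_eq 0 d d (by simp) (by simp)]; simp

lemma green_one (d : ℕ) : greenPow 1 d = d - 1 := by
  cases d with
  | zero => simp
  | succ d => rw [green_eq 0 (d + 1) d (by simp) (by simp) (by simp)]; simp

lemma mac_choose (n j : ℕ) : macaulayPow (n + 1) (Nat.choose j (n + 1)) = Nat.choose (j + 1) (n + 2) := by
  by_cases h : n + 1 ≤ j
  · rw [mac_eq n _ j le_rfl]
    · simp
    · rw [Nat.choose_succ_succ' j n]
      have := Nat.choose_pos (show n ≤ j by omega)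
      omega
  · rw [Nat.choose_eq_zero_of_lt (by omega), Nat.choose_eq_zero_of_lt (by omega)]; simp

lemma mac_eq' (n d j : ℕ) (h1 : Nat.choose j (n + 2) ≤ d) (h2 : d ≤ Nat.choose (j + 1) (n + 2)) :
    macaulayPow (n + 2) d
      = Nat.choose (j + 1) (n + 3) + macaulayPow (n + 1) (d - Nat.choose j (n + 2)) := by
  rcases h2.lt_or_eq with h | h
  · exact mac_eq (n + 1) d j h1 h
  · subst h
    have h3 : (j + 1).choose (n + 2) - j.choose (n + 2) = j.choose (n + 1) := by
      rw [Nat.choose_succ_succ' j (n + 1)]; simp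
    rw [h3, mac_choose (n + 1), mac_choose n, Nat.choose_succ_succ' (j + 1)]
    ring

lemma mac_lt_succ (n d : ℕ) : macaulayPow n d < macaulayPow n (d + 1) := by
  induction n using Nat.strong_induction_on generalizing d with
  | _ n ih =>
  match n with
  | 0 => simp [macaulayPow]
  | 1 => rw [mac_one, mac_one, Nat.choose_succ_succ' (d + 1) 1]; simp
  | n + 2 =>
    rcases Nat.eq_zero_or_pos d with rfl | hd
    · have := mac_choose (n + 1) (n + 2)
      simp at this; simp [this]
    · obtain ⟨i, hi, h1, h2⟩ := exists_top (n + 1) d hd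
      simp only [Nat.add_assoc, Nat.reduceAdd] at h1 h2
      rw [mac_eq' n d (i + 1) h1 h2.le, mac_eq' n (d + 1) (i + 1) (by omega) h2]
      have := ih (n + 1) (by omega) (d - Nat.choose (i + 1) (n + 2))
      rw [show d + 1 - Nat.choose (i + 1) (n + 2) = d - Nat.choose (i + 1) (n + 2) + 1 by omega]
      omega

lemma mac_strictMono (n : ℕ) : StrictMono (macaulayPow n) := strictMono_nat_of_lt_succ (mac_lt_succ n)

lemma green_le (n r j : ℕ) (h : r < Nat.choose (j + 1) n) : greenPow n r ≤ Nat.choose j n := by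
  induction n generalizing r j with
  | zero => simp [greenPow]
  | succ n ih =>
    rcases Nat.eq_zero_or_pos r with rfl | hd
    · simp
    obtain ⟨i, hi, h1, h2⟩ := exists_top n r hd
    rw [green_eq n r i h1 h2 hd]
    have hij : i + 1 ≤ j := by
      by_contra hc
      have := Nat.choose_le_choose (n + 1) (show j + 1 ≤ i + 1 by omega)
      omega
    have h3 := ih (r - Nat.choose (i + 1) (n + 1)) i (by
      have := Nat.choose_succ_succ' (i + 1) n
      simp only [Nat.add_assoc, Nat.reduceAdd] at this
      omega)
    have h4 := Nat.choose_succ_succ' i n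
    have h5 := Nat.choose_le_choose (n + 1) hij
    omega

lemma mac_green (n a : ℕ) : a + macaulayPow (n + 1) (greenPow (n + 1) a) ≤ macaulayPow (n + 1) a := by
  induction n generalizing a with
  | zero =>
    simp only [Nat.zero_add]
    rw [green_one, mac_one, mac_one]
    cases a with
    | zero => simp
    | succ a => simp [Nat.choose_succ_succ' (a + 1) 1]
  | succ n ih =>
    rcases Nat.eq_zero_or_pos a with rfl | hd
    · simp
    obtain ⟨i, hi, h1, h2⟩ := exists_top (n + 1) a hd
    rw [mac_eq (n + 1) a (i + 1) h1 h2, green_eq (n + 1) a i h1 h2 hd]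
    obtain ⟨r, rfl⟩ := Nat.exists_eq_add_of_le h1
    rw [Nat.add_sub_cancel_left]
    have h3 := Nat.choose_succ_succ' (i + 1) (n + 1)
    have h4 := green_le (n + 1) r i (by
      simp only [Nat.add_assoc, Nat.reduceAdd] at h3 h2 ⊢; omega)
    rw [mac_eq' n _ i (by simp) (by
      rw [Nat.choose_succ_succ' i (n + 1)]; omega),
      Nat.add_sub_cancel_left]
    have h5 := ih r
    have h6 := Nat.choose_succ_succ' (i + 1) (n + 2)
    simp only [Nat.add_assoc, Nat.reduceAdd] at *
    omega

lemma le_green (n a b : ℕ) (h : a ≤ macaulayPow n b) : a ≤ b + greenPow (n + 1) a := by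
  induction n generalizing a b with
  | zero => simp [macaulayPow] at h; omega
  | succ n ih =>
    rcases Nat.eq_zero_or_pos a with rfl | hd
    · simp
    obtain ⟨i, hi, h1, h2⟩ := exists_top (n + 1) a hd
    rw [green_eq (n + 1) a i h1 h2 hd]
    obtain ⟨r, rfl⟩ := Nat.exists_eq_add_of_le h1
    rw [Nat.add_sub_cancel_left]
    have h3 := Nat.choose_succ_succ' (i + 1) (n + 1)
    have h4 := Nat.choose_succ_succ' i (n + 1)
    have h5 := Nat.choose_succ_succ' i n
    have hb : Nat.choose i (n + 1) ≤ b := by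
      rw [← (mac_strictMono (n + 1)).le_iff_le, mac_choose]; simp only [Nat.add_assoc, Nat.reduceAdd] at *; omega
    by_cases hb2 : b < Nat.choose (i + 1) (n + 1)
    · rw [mac_eq n b i hb hb2] at h
      have := ih r (b - Nat.choose i (n + 1)) (by simp only [Nat.add_assoc, Nat.reduceAdd] at *; omega)
      simp only [Nat.add_assoc, Nat.reduceAdd] at *
      omega
    · have : r ≤ Nat.choose i n + greenPow (n + 1) r := by
        cases n with
        | zero => simp [green_one]; omega
        | succ n =>
          apply ih
          rw [mac_choose]
          simp only [Nat.add_assoc, Nat.reduceAdd] at *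
          omega
      simp only [Nat.add_assoc, Nat.reduceAdd] at *
      omega

/-- The numerical heart of the induction. -/
lemma mac_step (n a b : ℕ) (h : a ≤ macaulayPow n b) :
    a + macaulayPow (n + 1) (a - b) ≤ macaulayPow (n + 1) a := by
  refine le_trans ?_ (mac_green n a)
  have := le_green n a b h
  have := (mac_strictMono (n + 1)).monotone (show a - b ≤ greenPow (n + 1) a by omega)
  omega

open Finset

set_option linter.unusedSectionVars false
set_option linter.unusedSimpArgs false

section Comb

variable {ι : Type*} [DecidableEq ι] [Fintype ι]

/-- The lower shadow of a family of exponent vectors. -/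
def shadow (F : Finset (ι → ℕ)) : Finset (ι → ℕ) :=
  F.biUnion fun f => (univ.filter fun i => 0 < f i).image fun i => f - Pi.single i 1

lemma mem_shadow {F : Finset (ι → ℕ)} {e : ι → ℕ} :
    e ∈ shadow F ↔ ∃ i, e + Pi.single i 1 ∈ F := by
  simp only [shadow, mem_biUnion, mem_image, mem_filter, mem_univ, true_and]
  constructor
  · rintro ⟨f, hf, i, hi, rfl⟩
    refine ⟨i, ?_⟩
    convert hf
    ext k
    by_cases hk : k = i
    · subst hk; simp; omega
    · simp [Pi.single_apply, hk]
  · rintro ⟨i, hi⟩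
    exact ⟨_, hi, i, by simp, by ext k; simp⟩

/-- Move along the string in directions `o`, `j`. -/
def mk (o j : ι) (e : ι → ℕ) (b : ℕ) : ι → ℕ :=
  fun i => if i = j then b else if i = o then e o + e j - b else e i

/-- Positions of `F` on the string through `e`. -/
def str (o j : ι) (F : Finset (ι → ℕ)) (e : ι → ℕ) : Finset ℕ :=
  (range (e o + e j + 1)).filter fun b => mk o j e b ∈ F

/-- Compression along strings. -/
def comp (o j : ι) (F : Finset (ι → ℕ)) : Finset (ι → ℕ) :=
  F.biUnion fun f => (range (str o j F f).card).image (mk o j f)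

variable {o j : ι} 

lemma mk_self (e : ι → ℕ) : mk o j e (e j) = e := by
  ext i; simp only [mk]; split_ifs <;> simp_all

lemma mk_tot (hoj : o ≠ j) (e : ι → ℕ) {b : ℕ} (hb : b ≤ e o + e j) :
    mk o j e b o + mk o j e b j = e o + e j := by
  simp [mk, hoj]; omega

lemma mk_mk (hoj : o ≠ j) (e : ι → ℕ) {b : ℕ} (c : ℕ) (hb : b ≤ e o + e j) :
    mk o j (mk o j e b) c = mk o j e c := by
  ext i; simp only [mk]; split_ifs <;> first | rfl | omega

lemma mk_j (e : ι → ℕ) (b : ℕ) : mk o j e b j = b := by simp [mk]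

lemma str_mk (hoj : o ≠ j) (F : Finset (ι → ℕ)) (e : ι → ℕ) {b : ℕ} (hb : b ≤ e o + e j) :
    str o j F (mk o j e b) = str o j F e := by
  simp only [str, mk_tot hoj e hb, mk_mk hoj e _ hb]

lemma card_str_le (F : Finset (ι → ℕ)) (e : ι → ℕ) : (str o j F e).card ≤ e o + e j + 1 := by
  unfold str
  exact (card_filter_le _ _).trans (by simp)

lemma mem_comp (hoj : o ≠ j) {F : Finset (ι → ℕ)} {e : ι → ℕ} :
    e ∈ comp o j F ↔ e j < (str o j F e).card := by
  simp only [comp, mem_biUnion, mem_image, mem_range]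
  constructor
  · rintro ⟨f, hf, b, hb, rfl⟩
    have := card_str_le (o := o) (j := j) F f
    rw [str_mk hoj F f (by omega), mk_j]; exact hb
  · intro h
    obtain ⟨b, hb⟩ := card_pos.1 (by omega : 0 < (str o j F e).card)
    have hb' := hb
    simp only [str, mem_filter, mem_range] at hb
    refine ⟨_, hb.2, e j, ?_, ?_⟩
    · rwa [str_mk hoj F e (by omega)]
    · rw [mk_mk hoj e _ (by omega), mk_self]

lemma str_comp (hoj : o ≠ j) (F : Finset (ι → ℕ)) (e : ι → ℕ) :
    str o j (comp o j F) e = range (str o j F e).card := by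
  ext b
  have := card_str_le (o := o) (j := j) F e
  rw [str, mem_filter, mem_range, mem_range]
  constructor
  · rintro ⟨h1, h2⟩
    rwa [mem_comp hoj, mk_j, str_mk hoj F e (by omega)] at h2
  · intro h
    refine ⟨by omega, ?_⟩
    rwa [mem_comp hoj, mk_j, str_mk hoj F e (by omega)]

lemma sum_str (hoj : o ≠ j) (F Q : Finset (ι → ℕ)) (w : (ι → ℕ) → ℕ)
    (hQ : ∀ f ∈ F, mk o j f 0 ∈ Q) (hQ0 : ∀ q ∈ Q, q j = 0) :
    ∑ f ∈ F, w f = ∑ q ∈ Q, ∑ b ∈ str o j F q, w (mk o j q b) := by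
  rw [← sum_fiberwise_of_maps_to hQ]
  refine sum_congr rfl fun q hq => ?_
  symm
  have hq0 := hQ0 q hq
  refine sum_bij (fun b _ => mk o j q b) ?_ ?_ ?_ ?_
  · intro b hb
    simp only [str, mem_filter, mem_range] at hb
    refine mem_filter.2 ⟨hb.2, ?_⟩
    rw [mk_mk hoj q _ (by omega), ← hq0, mk_self]
  · intro a _ b _ h
    simpa [mk_j] using congrFun h j
  · intro f hf
    simp only [mem_filter] at hf
    obtain ⟨hf, rfl⟩ := hf
    have hh : mk o j (mk o j f 0) (f j) = f := by rw [mk_mk hoj f _ (by omega), mk_self]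
    refine ⟨f j, ?_, hh⟩
    simp only [str, mem_filter, mem_range, hh, mk_tot hoj f (Nat.zero_le _)]
    exact ⟨by omega, hf⟩
  · intros; rfl

/-- Representatives of the strings. -/
def reps (o j : ι) (F : Finset (ι → ℕ)) : Finset (ι → ℕ) := F.image fun f => mk o j f 0

lemma comp_reps (hoj : o ≠ j) (F : Finset (ι → ℕ)) : ∀ f ∈ comp o j F, mk o j f 0 ∈ reps o j F := by
  intro f hf
  simp only [comp, mem_biUnion, mem_image, mem_range] at hf
  obtain ⟨f, hf, b, hb, rfl⟩ := hf
  have := card_str_le (o := o) (j := j) F f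
  rw [mk_mk hoj f _ (by omega)]
  exact mem_image_of_mem _ hf

lemma card_comp (hoj : o ≠ j) (F : Finset (ι → ℕ)) : (comp o j F).card = F.card := by
  have hq0 : ∀ q ∈ reps o j F, q j = 0 := by
    intro q hq
    obtain ⟨f, _, rfl⟩ := mem_image.1 hq
    exact mk_j f 0
  rw [card_eq_sum_ones, card_eq_sum_ones,
    sum_str hoj (comp o j F) (reps o j F) _ (comp_reps hoj F) hq0,
    sum_str hoj F (reps o j F) _ (fun f hf => mem_image_of_mem _ hf) hq0]
  simp [str_comp hoj]

lemma sum_mk (hoj : o ≠ j) (e : ι → ℕ) {b : ℕ} (hb : b ≤ e o + e j) :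
    ∑ i, mk o j e b i = ∑ i, e i := by
  have key : ∀ f : ι → ℕ, ∑ i, f i = f o + f j + ∑ i ∈ (univ.erase j).erase o, f i := by
    intro f
    rw [← add_sum_erase univ f (mem_univ j),
      ← add_sum_erase (univ.erase j) f (mem_erase.2 ⟨hoj, mem_univ o⟩)]
    ring
  rw [key, key e, mk_tot hoj e hb]
  congr 1
  refine sum_congr rfl fun i hi => ?_
  simp only [mem_erase] at hi
  simp [mk, hi.1, hi.2.1]

lemma deg_comp (hoj : o ≠ j) (F : Finset (ι → ℕ)) (d : ℕ) (hF : ∀ f ∈ F, ∑ i, f i = d) :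
    ∀ f ∈ comp o j F, ∑ i, f i = d := by
  intro f hf
  simp only [comp, mem_biUnion, mem_image, mem_range] at hf
  obtain ⟨f, hf, b, hb, rfl⟩ := hf
  have := card_str_le (o := o) (j := j) F f
  rw [sum_mk hoj f (by omega), hF f hf]

lemma sum_range_card_le (B : Finset ℕ) :
    ∑ b ∈ range B.card, b ≤ ∑ b ∈ B, b ∧
      (B ≠ range B.card → ∑ b ∈ range B.card, b < ∑ b ∈ B, b) := by
  have h1 := sum_inter_add_sum_sdiff (range B.card) B (fun b : ℕ => b)
  have h2 := sum_inter_add_sum_sdiff B (range B.card) (fun b : ℕ => b)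
  rw [inter_comm B] at h2
  have hc : (range B.card \ B).card = (B \ range B.card).card := by
    have h3 := card_sdiff_add_card_inter (range B.card) B
    have h4 := card_sdiff_add_card_inter B (range B.card)
    rw [inter_comm B] at h4
    simp only [card_range] at h3
    omega
  have h5 : (B \ range B.card).card * B.card ≤ ∑ b ∈ B \ range B.card, b := by
    have := card_nsmul_le_sum (B \ range B.card) (fun b => b) B.card (by
      intro x hx; simp at hx; exact hx.2)
    simpa using this
  have h6 : ∑ b ∈ range B.card \ B, (b + 1) ≤ (range B.card \ B).card * B.card := by
    have := sum_le_card_nsmul (range B.card \ B) (fun b => b + 1) B.card (by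
      intro x hx; simp at hx; exact hx.1)
    simpa using this
  rw [sum_add_distrib, ← card_eq_sum_ones, hc] at h6
  refine ⟨by omega, fun hne => ?_⟩
  have : 0 < (B \ range B.card).card := by
    rw [card_pos, sdiff_nonempty]
    intro hs
    exact hne (eq_of_subset_of_card_le hs (by simp))
  omega

lemma str_shadow_aux (B B' : Finset ℕ) (t : ℕ) (hB : B ⊆ range (t + 2))
    (h1 : ∀ b ∈ B, b ≤ t → b ∈ B') (h2 : ∀ b, b + 1 ∈ B → b ∈ B') :
    B.card ≤ B'.card + 1 ∧ (B.card ≤ t + 1 → B.card ≤ B'.card) := by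
  constructor
  · have : B.erase (t + 1) ⊆ B' := by
      intro b hb
      simp only [mem_erase] at hb
      have := hB hb.2
      simp at this
      exact h1 b hb.2 (by omega)
    have := card_le_card this
    have := pred_card_le_card_erase (s := B) (a := t + 1)
    omega
  · intro hc
    obtain ⟨s, hs, hsB⟩ : ∃ s ∈ range (t + 2), s ∉ B := by
      by_contra! hcon
      have := card_le_card (show range (t + 2) ⊆ B from hcon)
      simp at this; omega
    simp only [mem_range] at hs
    refine card_le_card_of_injOn (fun b => if b < s then b else b - 1) ?_ ?_
    · intro b hb
      have hbs : b ≠ s := by rintro rfl; exact hsB hb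
      simp only
      split_ifs with h
      · exact h1 b hb (by omega)
      · exact h2 _ (by rwa [Nat.sub_add_cancel (by omega)])
    · intro a ha b hb hab
      have has : a ≠ s := by rintro rfl; exact hsB ha
      have hbs : b ≠ s := by rintro rfl; exact hsB hb
      simp only at hab
      split_ifs at hab <;> omega

lemma mk_add_other {i : ι} (hio : i ≠ o) (hij : i ≠ j) (e : ι → ℕ) (b : ℕ) :
    mk o j (e + Pi.single i 1) b = mk o j e b + Pi.single i 1 := by
  ext k
  simp only [mk, Pi.add_apply, Pi.single_apply, hio.symm, hij.symm, if_false, add_zero]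
  split_ifs <;> simp_all

lemma mk_add_o {i : ι} (hoj : o ≠ j) (hi : i = o ∨ i = j) (e : ι → ℕ) {b : ℕ} (hb : b ≤ e o + e j) :
    mk o j (e + Pi.single i 1) b = mk o j e b + Pi.single o 1 := by
  ext k
  rcases hi with rfl | rfl <;> simp only [mk, Pi.add_apply, Pi.single_apply] <;> grind

lemma mk_add_j {i : ι} (hoj : o ≠ j) (hi : i = o ∨ i = j) (e : ι → ℕ) (b : ℕ) :
    mk o j (e + Pi.single i 1) (b + 1) = mk o j e b + Pi.single j 1 := by
  ext k
  rcases hi with rfl | rfl <;> simp only [mk, Pi.add_apply, Pi.single_apply] <;> grind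

lemma shadow_comp (hoj : o ≠ j) (F : Finset (ι → ℕ)) : shadow (comp o j F) ⊆ comp o j (shadow F) := by
  intro e he
  obtain ⟨i, hi⟩ := mem_shadow.1 he
  rw [mem_comp hoj] at hi ⊢
  by_cases h : i = o ∨ i = j
  · have htot : (e + Pi.single i 1 : ι → ℕ) o + (e + Pi.single i 1 : ι → ℕ) j = e o + e j + 1 := by
      rcases h with rfl | rfl <;> simp [Pi.single_apply, hoj, hoj.symm] <;> ring
    have := str_shadow_aux (str o j F (e + Pi.single i 1)) (str o j (shadow F) e) (e o + e j)
      (by unfold str; rw [htot]; exact filter_subset _ _)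
      (by
        intro b hb hbt
        simp only [str, mem_filter, mem_range] at hb ⊢
        refine ⟨by omega, mem_shadow.2 ⟨o, ?_⟩⟩
        rw [← mk_add_o hoj h e hbt]; exact hb.2)
      (by
        intro b hb
        simp only [str, mem_filter, mem_range] at hb ⊢
        refine ⟨by omega, mem_shadow.2 ⟨j, ?_⟩⟩
        rw [← mk_add_j hoj h e b]; exact hb.2)
    rcases h with rfl | rfl
    · simp [hoj.symm] at hi
      omega
    · simp at hi
      omega
  · push Not at h
    refine lt_of_le_of_lt ?_ (lt_of_lt_of_le hi (card_le_card ?_))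
    · simp
    · intro b hb
      simp only [str, mem_filter, mem_range] at hb ⊢
      refine ⟨?_, mem_shadow.2 ⟨i, ?_⟩⟩
      · simpa [Pi.single_apply, h.1.symm, h.2.symm] using hb.1
      · rw [← mk_add_other h.1 h.2]; exact hb.2

lemma card_shadow_comp (hoj : o ≠ j) (F : Finset (ι → ℕ)) :
    (shadow (comp o j F)).card ≤ (shadow F).card := by
  rw [← card_comp hoj (shadow F)]
  exact card_le_card (shadow_comp hoj F)

/-- The potential. -/
def pot (o : ι) (F : Finset (ι → ℕ)) : ℕ := ∑ f ∈ F, (∑ i, f i - f o)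

lemma pot_comp (hoj : o ≠ j) (F : Finset (ι → ℕ)) (e : ι → ℕ) (h1 : e + Pi.single j 1 ∈ F)
    (h2 : e + Pi.single o 1 ∉ F) : pot o (comp o j F) < pot o F := by
  have hq0 : ∀ q ∈ reps o j F, q j = 0 := by
    intro q hq
    obtain ⟨f, _, rfl⟩ := mem_image.1 hq
    exact mk_j f 0
  unfold pot
  rw [sum_str hoj (comp o j F) (reps o j F) _ (comp_reps hoj F) hq0,
    sum_str hoj F (reps o j F) _ (fun f hf => mem_image_of_mem _ hf) hq0]
  have key : ∀ q ∈ reps o j F, ∀ G : Finset (ι → ℕ),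
      ∑ b ∈ str o j G q, (∑ i, mk o j q b i - mk o j q b o)
        = (str o j G q).card * (∑ i, q i - q o) + ∑ b ∈ str o j G q, b := by
    intro q hq G
    rw [← smul_eq_mul, ← sum_const, ← sum_add_distrib]
    refine sum_congr rfl fun b hb => ?_
    simp only [str, mem_filter, mem_range] at hb
    have h0 := hq0 q hq
    rw [sum_mk hoj q (by omega)]
    have h3 : mk o j q b o = q o - b := by simp [mk, hoj, h0]
    have h4 : q o ≤ ∑ i, q i := single_le_sum (f := q) (fun _ _ => Nat.zero_le _) (mem_univ o)
    rw [h3]; omega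
  refine sum_lt_sum ?_ ⟨mk o j (e + Pi.single j 1) 0, mem_image_of_mem _ h1, ?_⟩
  · intro q hq
    rw [key q hq, key q hq, str_comp hoj, card_range]
    have := (sum_range_card_le (str o j F q)).1
    omega
  · have hq := mem_image_of_mem (fun f => mk o j f 0) h1
    rw [key _ hq, key _ hq, str_comp hoj, card_range]
    have := (sum_range_card_le (str o j F (mk o j (e + Pi.single j 1) 0))).2 ?_
    · simpa using this
    · intro heq
      rw [str_mk hoj _ _ (Nat.zero_le _)] at heq
      have m1 : e j + 1 ∈ str o j F (e + Pi.single j 1) := by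
        simp only [str, mem_filter, mem_range]
        refine ⟨by simp, ?_⟩
        have := mk_self (o := o) (j := j) (e + Pi.single j 1)
        simp only [Pi.add_apply, Pi.single_eq_same] at this
        rwa [this]
      have m2 : e j ∈ str o j F (e + Pi.single j 1) := by
        rw [heq, mem_range] at m1 ⊢; omega
      simp only [str, mem_filter, mem_range] at m2
      apply h2
      have := m2.2
      rwa [mk_add_o hoj (Or.inr rfl) e (by omega), mk_self] at this

lemma exists_stable (o : ι) (d : ℕ) (F : Finset (ι → ℕ)) (hF : ∀ f ∈ F, ∑ i, f i = d) :
    ∃ F' : Finset (ι → ℕ), (∀ f ∈ F', ∑ i, f i = d) ∧ F'.card = F.card ∧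
      (shadow F').card ≤ (shadow F).card ∧
      ∀ (e : ι → ℕ) j, e + Pi.single j 1 ∈ F' → e + Pi.single o 1 ∈ F' := by
  induction hp : pot o F using Nat.strong_induction_on generalizing F with
  | _ p ih =>
  by_cases hs : ∀ (e : ι → ℕ) j, e + Pi.single j 1 ∈ F → e + Pi.single o 1 ∈ F
  · exact ⟨F, hF, rfl, le_rfl, hs⟩
  · push Not at hs
    obtain ⟨e, j, h1, h2⟩ := hs
    have hoj : o ≠ j := by rintro rfl; exact h2 h1
    obtain ⟨F', a1, a2, a3, a4⟩ := ih _ (hp ▸ pot_comp hoj F e h1 h2) (comp o j F)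
      (deg_comp hoj F d hF) rfl
    exact ⟨F', a1, a2.trans (card_comp hoj F), a3.trans (card_shadow_comp hoj F), a4⟩

lemma mem_shadow_stable {o : ι} {F : Finset (ι → ℕ)}
    (hs : ∀ (e : ι → ℕ) j, e + Pi.single j 1 ∈ F → e + Pi.single o 1 ∈ F) (e : ι → ℕ) :
    e ∈ shadow F ↔ e + Pi.single o 1 ∈ F := by
  rw [mem_shadow]
  exact ⟨fun ⟨j, hj⟩ => hs e j hj, fun h => ⟨o, h⟩⟩

lemma card_stable {o : ι} {F : Finset (ι → ℕ)}
    (hs : ∀ (e : ι → ℕ) j, e + Pi.single j 1 ∈ F → e + Pi.single o 1 ∈ F) :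
    F.card = (F.filter fun e => e o = 0).card + (shadow F).card := by
  rw [← card_filter_add_card_filter_not (s := F) (fun e => e o = 0)]
  congr 1
  symm
  refine card_bij (fun e _ => e + Pi.single o 1) ?_ ?_ ?_
  · intro e he
    rw [mem_shadow_stable hs] at he
    simp [he]
  · intro a _ b _ h; exact add_right_cancel h
  · intro f hf
    rw [mem_filter] at hf
    have : f - Pi.single o 1 + Pi.single o 1 = f := by
      ext k
      by_cases hk : k = o
      · subst hk; simp; omega
      · simp [Pi.single_apply, hk]
    exact ⟨f - Pi.single o 1, by rw [mem_shadow_stable hs, this]; exact hf.1, this⟩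

end Comb

theorem macaulay_comb (m n : ℕ) (F : Finset (Fin m → ℕ)) (hF : ∀ f ∈ F, ∑ i, f i = n + 2) :
    F.card ≤ macaulayPow (n + 1) (shadow F).card := by
  induction m generalizing n with
  | zero =>
    have : F = ∅ := by
      rw [eq_empty_iff_forall_notMem]
      intro f hf
      have := hF f hf
      simp at this
    simp [this]
  | succ m ihm =>
  induction n using Nat.strong_induction_on generalizing F with
  | _ n ihn =>
  obtain ⟨F', a1, a2, a3, hs⟩ := exists_stable 0 (n + 2) F hF
  rw [← a2]
  refine le_trans ?_ ((mac_strictMono (n + 1)).monotone a3)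
  clear a3 a2 hF F
  have hsG : ∀ (e : Fin (m + 1) → ℕ) j, e + Pi.single j 1 ∈ shadow F' → e + Pi.single 0 1 ∈ shadow F' := by
    intro e j h
    rw [mem_shadow_stable hs] at h ⊢
    rw [add_right_comm] at h
    exact hs _ j h
  have degG : ∀ f ∈ shadow F', ∑ i, f i = n + 1 := by
    intro f hf
    rw [mem_shadow_stable hs] at hf
    have := a1 _ hf
    simp [sum_add_distrib] at this
    exact this
  have c1 := card_stable hs
  have c2 := card_stable hsG
  set G := shadow F' with hG
  have tinj : ∀ H : Finset (Fin (m + 1) → ℕ),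
      ((H.filter fun e => e 0 = 0).image Fin.tail).card = (H.filter fun e => e 0 = 0).card := by
    intro H
    apply card_image_of_injOn
    intro a ha b hb hab
    simp only [coe_filter, Set.mem_ofPred_eq] at ha hb
    rw [← Fin.cons_self_tail a, ← Fin.cons_self_tail b, hab, ha.2, hb.2]
  have memt : ∀ (H : Finset (Fin (m + 1) → ℕ)) (e : Fin m → ℕ),
      e ∈ (H.filter fun e => e 0 = 0).image Fin.tail ↔ (Fin.cons 0 e : Fin (m + 1) → ℕ) ∈ H := by
    intro H e
    simp only [mem_image, mem_filter]
    constructor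
    · rintro ⟨f, ⟨h1, h2⟩, rfl⟩
      rw [← h2, Fin.cons_self_tail]; exact h1
    · intro h
      exact ⟨_, ⟨h, by simp⟩, by simp⟩
  have hsub : shadow ((F'.filter fun e => e 0 = 0).image Fin.tail) ⊆
      (G.filter fun e => e 0 = 0).image Fin.tail := by
    intro e he
    obtain ⟨i, hi⟩ := mem_shadow.1 he
    rw [memt] at hi ⊢
    rw [hG, mem_shadow]
    refine ⟨i.succ, ?_⟩
    convert hi using 1
    ext k
    refine Fin.cases ?_ (fun k => ?_) k
    · simp [Pi.single_apply, (Fin.succ_ne_zero i).symm]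
    · simp [Pi.single_apply]
  have b1 := ihm n ((F'.filter fun e => e 0 = 0).image Fin.tail) (by
    intro e he
    rw [memt] at he
    have := a1 _ he
    simpa [Fin.sum_univ_succ] using this)
  have b2 := b1.trans ((mac_strictMono (n + 1)).monotone (card_le_card hsub))
  rw [tinj, tinj, show (G.filter fun e => e 0 = 0).card = G.card - (shadow G).card by omega] at b2
  refine le_trans (by omega : F'.card ≤ G.card + macaulayPow (n + 1) (G.card - (shadow G).card)) ?_
  cases n with
  | succ n => exact mac_step _ _ _ (ihn n (by omega) G degG)
  | zero =>
    refine le_trans ?_ (mac_green 0 G.card)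
    rw [green_one]
    have : G.card - (shadow G).card ≤ G.card - 1 := by
      rcases G.eq_empty_or_nonempty with h | ⟨g, hg⟩
      · simp [h]
      · have h1 : ∃ i, 0 < g i := by
          by_contra! hcon
          have := degG g hg
          simp [fun i => Nat.le_zero.1 (hcon i)] at this
        obtain ⟨i, hi⟩ := h1
        have : g - Pi.single i 1 ∈ shadow G := by
          unfold shadow
          exact mem_biUnion.2 ⟨g, hg, mem_image.2 ⟨i, by simpa using hi, rfl⟩⟩
        have := card_pos.2 ⟨_, this⟩
        omega
    have := (mac_strictMono (0 + 1)).monotone this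
    omega

section Alg

variable {ι L K V : Type*} [LinearOrder L] [Field K] [AddCommGroup V] [Module K V]

open Classical in
/-- Greedy basis of a finite family. -/
noncomputable def greedy (K : Type*) [Field K] [Module K V] (key : ι → L) (v : ι → V)
    (D : Finset ι) : Finset ι :=
  D.filter fun e => v e ∉ Submodule.span K (v '' {f | f ∈ D ∧ key f < key e})

lemma greedy_spec (key : ι → L) (hk : Function.Injective key) (v : ι → V) (D : Finset ι) :
    LinearIndepOn K v (greedy K key v D : Set ι) ∧
      Submodule.span K (v '' (greedy K key v D : Set ι)) = Submodule.span K (v '' (D : Set ι)) := by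
  classical
  induction D using Finset.induction_on_max_value key with
  | empty => simp [greedy]
  | insert a s ha hmax ih =>
    have hlt : ∀ x ∈ s, key x < key a := fun x hx =>
      lt_of_le_of_ne (hmax x hx) (fun h => ha (hk h ▸ hx))
    have e1 : ∀ x ∈ s, {f | f ∈ insert a s ∧ key f < key x} = {f | f ∈ s ∧ key f < key x} := by
      intro x hx
      ext f
      simp only [mem_insert, Set.mem_ofPred_eq]
      constructor
      · rintro ⟨rfl | h, h2⟩
        · exact absurd h2 (hlt x hx).asymm
        · exact ⟨h, h2⟩
      · rintro ⟨h, h2⟩; exact ⟨Or.inr h, h2⟩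
    have e2 : {f | f ∈ insert a s ∧ key f < key a} = (s : Set ι) := by
      ext f
      simp only [mem_insert, Set.mem_ofPred_eq, mem_coe]
      constructor
      · rintro ⟨rfl | h, h2⟩
        · exact absurd h2 (lt_irrefl _)
        · exact h
      · intro h; exact ⟨Or.inr h, hlt f h⟩
    have e3 : s.filter (fun e => v e ∉ Submodule.span K (v '' {f | f ∈ insert a s ∧ key f < key e}))
        = greedy K key v s := by
      unfold greedy
      refine filter_congr fun x hx => ?_
      rw [e1 x hx]
    have hsub : greedy K key v s ⊆ s := filter_subset _ _
    by_cases h : v a ∈ Submodule.span K (v '' (s : Set ι))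
    · have : greedy K key v (insert a s) = greedy K key v s := by
        rw [← e3, greedy, filter_insert, if_neg (by rw [e2]; simpa using h)]
      rw [this]
      refine ⟨ih.1, ?_⟩
      rw [ih.2, coe_insert, Set.image_insert_eq, Submodule.span_insert_eq_span h]
    · have : greedy K key v (insert a s) = insert a (greedy K key v s) := by
        rw [← e3, greedy, filter_insert, if_pos (by rw [e2]; exact h)]
      rw [this, coe_insert, coe_insert]
      constructor
      · rw [linearIndepOn_insert (fun hh => ha (hsub hh))]
        exact ⟨ih.1, by rw [ih.2]; exact h⟩
      · rw [Set.image_insert_eq, Set.image_insert_eq, Submodule.span_insert, Submodule.span_insert, ih.2]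

lemma finrank_greedy (key : ι → L) (hk : Function.Injective key) (v : ι → V) (D : Finset ι) :
    Module.finrank K (Submodule.span K (v '' (D : Set ι))) = (greedy K key v D).card := by
  obtain ⟨h1, h2⟩ := greedy_spec (K := K) key hk v D
  rw [← h2]
  have := finrank_span_eq_card (R := K) (b := fun x : (greedy K key v D) => v x) h1
  rw [Fintype.card_coe] at this
  rw [← this]
  have hr : Set.range (fun x : (greedy K key v D) => v x) = v '' (greedy K key v D : Set ι) := by
    ext; simp
  rw [hr]

end Alg

section Main

variable {k : Type*} [Field k] {m : ℕ}

/-- The residue class of a monomial. -/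
noncomputable def mv (I : Ideal (MvPolynomial (Fin m) k)) (e : Fin m → ℕ) :
    MvPolynomial (Fin m) k ⧸ I :=
  Ideal.Quotient.mkₐ k I (monomial (Finsupp.equivFunOnFinite.symm e) 1)

lemma mv_add (I : Ideal (MvPolynomial (Fin m) k)) (e f : Fin m → ℕ) :
    mv I (e + f) = mv I f * mv I e := by
  unfold mv
  have h : Finsupp.equivFunOnFinite.symm (f + e)
      = Finsupp.equivFunOnFinite.symm f + Finsupp.equivFunOnFinite.symm e := by
    ext; simp
  rw [← map_mul, monomial_mul, mul_one, add_comm e f, h]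

lemma map_hom (I : Ideal (MvPolynomial (Fin m) k)) (n : ℕ) :
    Submodule.map (Ideal.Quotient.mkₐ k I).toLinearMap (homogeneousSubmodule (Fin m) k n)
      = Submodule.span k (mv I '' ((piAntidiag univ n : Finset (Fin m → ℕ)) : Set (Fin m → ℕ))) := by
  apply le_antisymm
  · rintro _ ⟨f, hf, rfl⟩
    rw [← support_sum_monomial_coeff f, map_sum]
    refine Submodule.sum_mem _ fun d hd => ?_
    have hd' : d.degree = n := by
      have := (mem_homogeneousSubmodule n f).1 hf (mem_support_iff.1 hd)
      rwa [Finsupp.degree_eq_weight_one]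
    have : monomial d (coeff d f) = coeff d f • monomial d (1 : k) := by
      rw [smul_monomial, smul_eq_mul, mul_one]
    rw [this, map_smul]
    refine Submodule.smul_mem _ _ (Submodule.subset_span ⟨d, ?_, ?_⟩)
    · rw [mem_coe, mem_piAntidiag]
      refine ⟨?_, by simp⟩
      rw [← hd', Finsupp.degree_eq_sum]
    · simp [mv]
  · rw [Submodule.span_le]
    rintro _ ⟨e, he, rfl⟩
    refine ⟨monomial (Finsupp.equivFunOnFinite.symm e) 1, ?_, rfl⟩
    rw [mem_coe, mem_piAntidiag] at he
    refine (mem_homogeneousSubmodule _ _).2 (isHomogeneous_monomial _ ?_)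
    rw [Finsupp.degree_eq_sum, ← he.1]
    rfl

/-- Standard exponents of degree `n`. -/
noncomputable def stdExp (I : Ideal (MvPolynomial (Fin m) k)) (n : ℕ) : Finset (Fin m → ℕ) :=
  greedy k (toLex : (Fin m → ℕ) → Lex (Fin m → ℕ)) (mv I) (piAntidiag univ n)

lemma hilb_eq (I : Ideal (MvPolynomial (Fin m) k)) (n : ℕ) :
    hilbertFunction k m I n = (stdExp I n).card := by
  rw [hilbertFunction, map_hom, finrank_greedy _ toLex.injective, stdExp]

lemma shadow_std (I : Ideal (MvPolynomial (Fin m) k)) (n : ℕ) :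
    shadow (stdExp I (n + 1)) ⊆ stdExp I n := by
  intro e he
  obtain ⟨i, hi⟩ := mem_shadow.1 he
  simp only [stdExp, greedy, mem_filter, mem_piAntidiag] at hi ⊢
  obtain ⟨⟨h1, -⟩, h2⟩ := hi
  refine ⟨⟨?_, by simp⟩, fun hmem => h2 ?_⟩
  · have h3 : ∑ x, (e + Pi.single i 1 : Fin m → ℕ) x = ∑ x, e x + 1 := by simp [sum_add_distrib]
    change ∑ x, (e + Pi.single i 1 : Fin m → ℕ) x = n + 1 at h1
    change ∑ x, e x = n
    omega
  · rw [mv_add]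
    have := Submodule.mem_map_of_mem (f := LinearMap.mulLeft k (mv I (Pi.single i 1))) hmem
    rw [Submodule.map_span] at this
    refine Submodule.span_mono ?_ this
    rintro _ ⟨_, ⟨f, ⟨⟨hf1, -⟩, hf2⟩, rfl⟩, rfl⟩
    refine ⟨f + Pi.single i 1, ⟨⟨?_, by simp⟩, ?_⟩, ?_⟩
    · change ∑ x, (f + Pi.single i 1 : Fin m → ℕ) x = n + 1
      change ∑ x, f x = n at hf1
      simp [sum_add_distrib, hf1]
    · change toLex f + toLex (Pi.single i 1) < toLex e + toLex (Pi.single i 1)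
      exact add_lt_add_left hf2 _
    · rw [mv_add]; rfl

end Main

end MacProof

/-- **Macaulay's theorem.** For a standard graded algebra `A` over a field `k`,
`HF_A(n+1) ≤ HF_A(n)^⟨n⟩` for all `n ≥ 1`. -/
theorem hilbertFunction_succ_le_macaulayPow (k : Type*) [Field k] (m : ℕ)
    (I : Ideal (MvPolynomial (Fin m) k)) (hI : I ≠ ⊤)
    (hhom : ∀ f ∈ I, ∀ n : ℕ, homogeneousComponent n f ∈ I) :
    ∀ n : ℕ, 1 ≤ n →
      hilbertFunction k m I (n + 1) ≤ macaulayPow n (hilbertFunction k m I n) := by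
  intro n hn
  obtain ⟨n, rfl⟩ : ∃ l, n = l + 1 := ⟨n - 1, by omega⟩
  rw [MacProof.hilb_eq, MacProof.hilb_eq]
  refine (MacProof.macaulay_comb m n _ ?_).trans
    ((MacProof.mac_strictMono (n + 1)).monotone (Finset.card_le_card (MacProof.shadow_std I (n + 1))))
  intro f hf
  simp only [MacProof.stdExp, MacProof.greedy, Finset.mem_filter, Finset.mem_piAntidiag] at hf
  exact hf.1.1
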